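/- Let A be a finite nonempty set and let μ be the product over a ∈ A of standard Gumbel measures on ℝ (each with density ε ↦ exp(−ε)·exp(−exp(−ε)) with respect to Lebesgue measure). Then for every q : A → ℝ, ∫ max_{a∈A} ( q(a) + ε(a) ) dμ(ε) = γ + log( Σ_{a∈A} exp(q(a)) ), where γ is the Euler–Mascheroni constant. -/

import Mathlib

open MeasureTheory

/-- The standard Gumbel measure on `ℝ`, with density `ε ↦ exp(−ε)·exp(−exp(−ε))`
with respect to Lebesgue measure. -/
noncomputable def stdGumbel : Measure ℝ :=
  volume.withDensity fun ε => ENNReal.ofReal (Real.exp (-ε) * Real.exp (-Real.exp (-ε)))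

open Set Filter Topology

theorem hasDerivAt_exp_neg (x : ℝ) :
    HasDerivAt (fun x : ℝ => Real.exp (-x)) (-Real.exp (-x)) x := by
  simpa using (hasDerivAt_neg x).exp

theorem antitone_exp_neg : Antitone fun x : ℝ => Real.exp (-x) := fun _ _ h =>
  Real.exp_le_exp.2 (neg_le_neg h)

theorem image_exp_neg_Iic (x : ℝ) :
    (fun y : ℝ => Real.exp (-y)) '' Iic x = Ici (Real.exp (-x)) := by
  ext u
  constructor
  · rintro ⟨y, hy, rfl⟩
    exact antitone_exp_neg hy
  · intro hu
    have hu0 : 0 < u := (Real.exp_pos _).trans_le hu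
    refine ⟨-Real.log u, ?_, by simp [Real.exp_log hu0]⟩
    have := (Real.le_log_iff_exp_le hu0).2 hu
    simp only [mem_Iic]
    linarith

theorem image_exp_neg_univ :
    (fun y : ℝ => Real.exp (-y)) '' univ = Ioi 0 := by
  ext u
  constructor
  · rintro ⟨y, -, rfl⟩
    exact Real.exp_pos _
  · intro hu
    exact ⟨-Real.log u, trivial, by simp [Real.exp_log hu]⟩

theorem stdGumbel_Iic (x : ℝ) :
    stdGumbel (Iic x) = ENNReal.ofReal (Real.exp (-Real.exp (-x))) := by
  have hcv := lintegral_image_eq_lintegral_deriv_mul_of_antitoneOn (measurableSet_Iic (a := x))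
    (fun y _ => (hasDerivAt_exp_neg y).hasDerivWithinAt) (antitone_exp_neg.antitoneOn _)
    (fun u => ENNReal.ofReal (Real.exp (-u)))
  rw [stdGumbel, withDensity_apply _ measurableSet_Iic]
  simp_rw [neg_neg, ← ENNReal.ofReal_mul (Real.exp_pos _).le] at hcv
  have hint : ∫ u in Ioi (Real.exp (-x)), Real.exp (-u) = Real.exp (-Real.exp (-x)) :=
    integral_exp_neg_Ioi _
  rw [← hcv, image_exp_neg_Iic, setLIntegral_congr Ioi_ae_eq_Ici.symm,
    ← ofReal_integral_eq_lintegral_ofReal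
      (.of_integral_ne_zero (hint ▸ (Real.exp_pos _).ne')) (ae_of_all _ fun _ => (Real.exp_pos _).le),
    hint]

instance isProbabilityMeasure_stdGumbel : IsProbabilityMeasure stdGumbel := by
  refine ⟨tendsto_nhds_unique (tendsto_measure_Iic_atTop stdGumbel) ?_⟩
  simp_rw [stdGumbel_Iic]
  have h : Tendsto (fun x : ℝ => Real.exp (-Real.exp (-x))) atTop (𝓝 (Real.exp (-0))) :=
    (Real.continuous_exp.tendsto _).comp Real.tendsto_exp_neg_atTop_nhds_zero.neg
  simpa using ENNReal.tendsto_ofReal h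

theorem integral_log_mul_exp_neg :
    ∫ t in Ioi (0 : ℝ), Real.log t * Real.exp (-t) = -Real.eulerMascheroniConstant := by
  have h1 := Complex.hasDerivAt_GammaIntegral (s := 1) (by simp)
  have heq : Complex.Gamma =ᶠ[𝓝 1] Complex.GammaIntegral := by
    filter_upwards [(isOpen_lt continuous_const Complex.continuous_re).mem_nhds
      (show (0 : ℝ) < (1 : ℂ).re by simp)] with s hs
    exact Complex.Gamma_eq_integral hs
  have h := h1.unique (Complex.hasDerivAt_Gamma_one.congr_of_eventuallyEq heq.symm)
  simp only [sub_self, Complex.cpow_zero, one_mul, ← Complex.ofReal_mul] at h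
  rw [integral_complex_ofReal] at h
  exact_mod_cast h

theorem integral_id_stdGumbel : ∫ x, x ∂stdGumbel = Real.eulerMascheroniConstant := by
  have hcv := integral_image_eq_integral_deriv_smul_of_antitoneOn MeasurableSet.univ
    (fun y _ => (hasDerivAt_exp_neg y).hasDerivWithinAt) (antitone_exp_neg.antitoneOn _)
    (fun u => Real.log u * Real.exp (-u))
  rw [image_exp_neg_univ, integral_log_mul_exp_neg, setIntegral_univ] at hcv
  rw [stdGumbel, integral_withDensity_eq_integral_toReal_smul (by fun_prop) (by simp),
    ← neg_neg Real.eulerMascheroniConstant, hcv, ← integral_neg]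
  refine integral_congr_ae (ae_of_all _ fun x => ?_)
  simp only [smul_eq_mul, Real.log_exp]
  rw [ENNReal.toReal_ofReal (by positivity)]
  ring

theorem integrable_id_stdGumbel : Integrable (fun x : ℝ => x) stdGumbel := by
  refine .of_integral_ne_zero ?_
  rw [integral_id_stdGumbel]
  linarith [Real.one_half_lt_eulerMascheroniConstant]

theorem map_iSup_add_pi_stdGumbel {A : Type*} [Fintype A] [Nonempty A] (q : A → ℝ) :
    (Measure.pi fun _ : A => stdGumbel).map (fun ε => ⨆ a, (q a + ε a)) =
      stdGumbel.map (· + Real.log (∑ a, Real.exp (q a))) := by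
  have hmeas : Measurable fun ε : A → ℝ => ⨆ a, (q a + ε a) := by fun_prop
  have : IsFiniteMeasure
      ((Measure.pi fun _ : A => stdGumbel).map (fun ε => ⨆ a, (q a + ε a))) :=
    Measure.isFiniteMeasure_map _ _
  refine Measure.ext_of_Iic _ _ fun x => ?_
  have hS : 0 < ∑ a, Real.exp (q a) :=
    Finset.sum_pos (fun a _ => Real.exp_pos _) Finset.univ_nonempty
  have hpre : (fun ε : A → ℝ => ⨆ a, (q a + ε a)) ⁻¹' Iic x =
      univ.pi fun a => Iic (x - q a) := by
    ext ε
    simp only [mem_preimage, mem_Iic, Set.mem_pi, mem_univ, true_imp_iff,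
      ciSup_le_iff (finite_range fun a => q a + ε a).bddAbove, le_sub_iff_add_le']
  have hpre' : (· + Real.log (∑ a, Real.exp (q a))) ⁻¹' Iic x =
      Iic (x - Real.log (∑ a, Real.exp (q a))) := by
    ext y
    simp [le_sub_iff_add_le]
  rw [Measure.map_apply hmeas measurableSet_Iic,
    Measure.map_apply (by fun_prop) measurableSet_Iic, hpre, hpre', Measure.pi_pi]
  simp_rw [stdGumbel_Iic]
  rw [← ENNReal.ofReal_prod_of_nonneg fun _ _ => (Real.exp_pos _).le, ← Real.exp_sum]
  simp_rw [neg_sub, Real.exp_sub, Real.exp_log hS, Finset.sum_neg_distrib, Finset.sum_div]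

/-- Under i.i.d. standard Gumbel perturbations, the expected maximum of the perturbed payoffs
is the log-sum-exp shifted by the Euler–Mascheroni constant (Theorem 3 of the paper). -/
theorem gumbel_expected_max_logsumexp
    {A : Type*} [Fintype A] [Nonempty A]
    (q : A → ℝ) :
    ∫ ε, (⨆ a : A, (q a + ε a)) ∂(Measure.pi fun _ : A => stdGumbel) =
      Real.eulerMascheroniConstant + Real.log (∑ a : A, Real.exp (q a)) := by
  rw [← integral_map (f := fun x : ℝ => x) (φ := fun ε : A → ℝ => ⨆ a, (q a + ε a))
      (by have : Measurable fun ε : A → ℝ => ⨆ a, (q a + ε a) := by fun_prop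
          exact this.aemeasurable) (by fun_prop), map_iSup_add_pi_stdGumbel,
    integral_map (by fun_prop) (by fun_prop),
    integral_add integrable_id_stdGumbel (integrable_const _), integral_id_stdGumbel]
  simp
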